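/- Let n and m be two degree statistics and let 𝒯_n be uniformly random in 𝕋_n. Then for every positive integer q, E[(N_m(𝒯_n))_q] = |𝕋_m|^q · (|n| / (|n|)_{q|m|−q+1}) · Π_{i≥0} (n(i))_{q·m(i)}, where in the case |n| < q|m| − q + 1 the expression 0/0 is interpreted as 0. Equivalently, for any tree T with degree statistic m, E[(N_m(𝒯_n))_q] = |𝕋_m|^q · E[(N_T(𝒯_n))_q]. -/

import Mathlib

/-!
Common definitions: plane rooted trees, fringe subtree counts, random trees with
a given degree statistic, Poisson/normal limit notions, conditioned Galton–Watson
trees, and sampling without replacement.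
-/

open Filter MeasureTheory
open scoped Topology Classical

/-- A plane rooted tree: a root together with a linearly ordered (possibly empty)
list of subtrees. Structural equality coincides with isomorphism of plane rooted trees. -/
inductive PlaneTree : Type
  | node : List PlaneTree → PlaneTree

namespace PlaneTree

/-- The (out)degree of the root: its number of children. -/
def degree : PlaneTree → ℕ
  | node ts => ts.length

mutual
  /-- The list of all fringe subtrees of a tree (one for each vertex). -/
  def fringe : PlaneTree → List PlaneTree
    | node ts => node ts :: fringeList ts
  def fringeList : List PlaneTree → List PlaneTree
    | [] => []
    | t :: ts => fringe t ++ fringeList ts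
end

/-- The number of vertices `|T|` of a plane tree. -/
def size (T : PlaneTree) : ℕ := T.fringe.length

/-- The degree statistic `n_T` of a tree: `n_T(i)` is the number of vertices with `i` children. -/
noncomputable def degStat (T : PlaneTree) : ℕ →₀ ℕ :=
  Multiset.toFinsupp ((T.fringe.map degree : List ℕ) : Multiset ℕ)

/-- `N_{T'}(T)`: the number of fringe subtrees of `T` equal to `T'`. -/
noncomputable def countTree (T' T : PlaneTree) : ℕ :=
  (T.fringe.filter fun t => decide (t = T')).length

/-- `N_m(T)` for a degree statistic `m`: the number of fringe subtrees of `T`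
with degree statistic `m`. -/
noncomputable def countStat (m : ℕ →₀ ℕ) (T : PlaneTree) : ℕ :=
  (T.fringe.filter fun t => decide (degStat t = m)).length

/-- `N_m(T)` for an integer `m`: the number of fringe subtrees of `T` of size `m`. -/
noncomputable def countSize (m : ℕ) (T : PlaneTree) : ℕ :=
  (T.fringe.filter fun t => decide (size t = m)).length

end PlaneTree

/-- `n : ℕ →₀ ℕ` is a degree statistic: `∑ n(i) = 1 + ∑ i·n(i)`. -/
def IsDegStat (n : ℕ →₀ ℕ) : Prop :=
  (n.sum fun _ c => c) = 1 + n.sum fun i c => i * c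

/-- `|n| = ∑_i n(i)`, the size of a degree statistic. -/
def nsize (n : ℕ →₀ ℕ) : ℕ := n.sum fun _ c => c

/-- The set `𝕋_n` of plane trees with degree statistic `n`. -/
def treesWith (n : ℕ →₀ ℕ) : Set PlaneTree := {T | PlaneTree.degStat T = n}

/-- `|𝕋_n|`, the number of plane trees with degree statistic `n`. -/
noncomputable def numTrees (n : ℕ →₀ ℕ) : ℕ := (treesWith n).ncard

/-- The probability that a uniformly random tree `𝒯_n ∈ 𝕋_n` satisfies `P`. -/
noncomputable def prob (n : ℕ →₀ ℕ) (P : PlaneTree → Prop) : ℝ :=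
  (({T ∈ treesWith n | P T}).ncard : ℝ) / (numTrees n : ℝ)

/-- The expectation `E[f(𝒯_n)]` of an `ℕ`-valued functional of the uniformly
random tree `𝒯_n ∈ 𝕋_n`. -/
noncomputable def expect (n : ℕ →₀ ℕ) (f : PlaneTree → ℕ) : ℝ :=
  ∑' k : ℕ, (k : ℝ) * prob n (fun T => f T = k)

/-- The variance `Var[f(𝒯_n)]`. -/
noncomputable def variance (n : ℕ →₀ ℕ) (f : PlaneTree → ℕ) : ℝ :=
  expect n (fun T => (f T) ^ 2) - (expect n f) ^ 2

/-- The empirical degree distribution `p_i(n) = n(i)/|n|`. -/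
noncomputable def empDist (n : ℕ →₀ ℕ) (i : ℕ) : ℝ := (n i : ℝ) / (nsize n : ℝ)

/-- `π_p(T) = ∏_{i ≥ 0} p_i^{n_T(i)}`. -/
noncomputable def piDist (p : ℕ → ℝ) (T : PlaneTree) : ℝ :=
  (PlaneTree.degStat T).prod fun i c => p i ^ c

/-- `π_p(𝕋_m) = |𝕋_m| · ∏_{i ≥ 0} p_i^{m(i)}`. -/
noncomputable def piSet (p : ℕ → ℝ) (m : ℕ →₀ ℕ) : ℝ :=
  (numTrees m : ℝ) * m.prod fun i c => p i ^ c

/-- Condition 1: the `nseq κ` are degree statistics with `|n_κ| → ∞` and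
`p_i(n_κ) → p_i` for every `i`, where `p` is a probability distribution on `ℕ`. -/
def Condition1 (nseq : ℕ → (ℕ →₀ ℕ)) (p : ℕ → ℝ) : Prop :=
  (∀ κ, IsDegStat (nseq κ)) ∧
  Tendsto (fun κ => nsize (nseq κ)) atTop atTop ∧
  (∀ i, 0 ≤ p i) ∧ HasSum p 1 ∧
  (∀ i, Tendsto (fun κ => empDist (nseq κ) i) atTop (𝓝 (p i)))

/-- Condition 2: in addition, `∑ i² p_i(n_κ) → ∑ i² p_i < ∞`. -/
def Condition2 (nseq : ℕ → (ℕ →₀ ℕ)) (p : ℕ → ℝ) : Prop :=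
  Summable (fun i : ℕ => (i : ℝ) ^ 2 * p i) ∧
  Tendsto (fun κ => ∑' i : ℕ, (i : ℝ) ^ 2 * empDist (nseq κ) i) atTop
    (𝓝 (∑' i : ℕ, (i : ℝ) ^ 2 * p i))

/-- `σ_p² = ∑_{i ≥ 0} (i-1)² p_i`. -/
noncomputable def sigmaSq (p : ℕ → ℝ) : ℝ := ∑' i : ℕ, ((i : ℝ) - 1) ^ 2 * p i

/-- The point probabilities of the Poisson distribution `Po(lam)`. -/
noncomputable def poissonPMF (lam : ℝ) (k : ℕ) : ℝ :=
  Real.exp (-lam) * lam ^ k / (Nat.factorial k : ℝ)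

/-- The `q`-th moment of the Poisson distribution `Po(lam)`. -/
noncomputable def poissonMoment (lam : ℝ) (q : ℕ) : ℝ :=
  ∑' k : ℕ, (k : ℝ) ^ q * poissonPMF lam k

/-- The standard normal cumulative distribution function. -/
noncomputable def stdNormalCDF (x : ℝ) : ℝ :=
  ∫ t in Set.Iic x, Real.exp (-t ^ 2 / 2) / Real.sqrt (2 * Real.pi)

/-- The total variation distance between the law of `f(𝒯_n)` and `Po(lam)`:
`sup_A |P(f(𝒯_n) ∈ A) − Po(lam)(A)|`. -/
noncomputable def dTVPoisson (n : ℕ →₀ ℕ) (f : PlaneTree → ℕ) (lam : ℝ) : ℝ :=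
  ⨆ A : Set ℕ, |prob n (fun T => f T ∈ A) - ∑' k : ℕ, A.indicator (poissonPMF lam) k|

/-- A probability distribution on `ℕ` is nonlattice: the gcd of the differences of
points of its support is `1`. -/
def Nonlattice (p : ℕ → ℝ) : Prop :=
  ∀ h : ℕ, (∀ i j : ℕ, 0 < p i → 0 < p j → (h : ℤ) ∣ (i : ℤ) - (j : ℤ)) → h = 1

/-- The partition function `P(|𝒯_p| = n)` of a Galton–Watson tree with offspring
distribution `p`. -/
noncomputable def gwZ (p : ℕ → ℝ) (n : ℕ) : ℝ :=
  ∑' T : PlaneTree, if PlaneTree.size T = n then piDist p T else 0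

/-- `P(𝒯_{p,n} ∈ {T | P T})` for the conditioned Galton–Watson tree `𝒯_{p,n}`. -/
noncomputable def probGW (p : ℕ → ℝ) (n : ℕ) (P : PlaneTree → Prop) : ℝ :=
  (∑' T : PlaneTree, if PlaneTree.size T = n ∧ P T then piDist p T else 0) / gwZ p n

/-- The expectation `E[f(𝒯_{p,n})]` for an `ℕ`-valued functional. -/
noncomputable def expectGW (p : ℕ → ℝ) (n : ℕ) (f : PlaneTree → ℕ) : ℝ :=
  ∑' k : ℕ, (k : ℝ) * probGW p n (fun T => f T = k)

/-- The filter `n → ∞` along the sizes `n` for which the conditioning `|𝒯_p| = n`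
is well defined. -/
noncomputable def gwFilter (p : ℕ → ℝ) : Filter ℕ :=
  atTop ⊓ Filter.principal {n | 0 < gwZ p n}

/-- A positive function on the positive reals is slowly varying at infinity. -/
def SlowlyVarying (L : ℝ → ℝ) : Prop :=
  (∀ x : ℝ, 0 < x → 0 < L x) ∧
  ∀ c : ℝ, 0 < c → Tendsto (fun x : ℝ => L (c * x) / L x) atTop (𝓝 1)

/-- The probability that a uniformly random permutation of `Fin n` satisfies `P`. -/
noncomputable def probPerm {n : ℕ} (P : Equiv.Perm (Fin n) → Prop) : ℝ :=
  ((Finset.univ.filter P).card : ℝ) / ((Finset.univ : Finset (Equiv.Perm (Fin n))).card : ℝ)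

/-- `S_m = ∑_{i=1}^m d_{τ(i)}`: the sum of `m` of the values `d`, drawn without
replacement via the permutation `τ`. -/
def sampleSum {n : ℕ} (d : Fin n → ℤ) (m : ℕ) (τ : Equiv.Perm (Fin n)) : ℤ :=
  ∑ i : Fin n, if (i : ℕ) < m then d (τ i) else 0

/-- The mean `d̄` of the values `d`. -/
noncomputable def dbar {n : ℕ} (d : Fin n → ℤ) : ℝ := (∑ i : Fin n, (d i : ℝ)) / n

/-- `Q = ∑_i (d_i − d̄)²`. -/
noncomputable def Qval {n : ℕ} (d : Fin n → ℤ) : ℝ := ∑ i : Fin n, ((d i : ℝ) - dbar d) ^ 2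

/-- `σ̂² = (m/n)(1 − m/n) Q`. -/
noncomputable def sigHatSq {n : ℕ} (d : Fin n → ℤ) (m : ℕ) : ℝ :=
  ((m : ℝ) / n) * (1 - (m : ℝ) / n) * Qval d

/-- The empirical frequency `p_k(d) = #{i : d_i = k}/n`. -/
noncomputable def empFreq {n : ℕ} (d : Fin n → ℤ) (k : ℤ) : ℝ :=
  ((Finset.univ.filter (fun i => d i = k)).card : ℝ) / n

/-- The characteristic function `φ_{S_m}(t) = E[exp(i t S_m)]` of the sample sum. -/
noncomputable def charFn {n : ℕ} (d : Fin n → ℤ) (m : ℕ) (t : ℝ) : ℂ :=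
  (Fintype.card (Equiv.Perm (Fin n)) : ℂ)⁻¹ *
    ∑ τ : Equiv.Perm (Fin n), Complex.exp (Complex.I * t * (sampleSum d m τ : ℂ))

/-- A probability distribution on `ℤ` is nonlattice. -/
def NonlatticeZ (p : ℤ → ℝ) : Prop :=
  ∀ h : ℕ, (∀ i j : ℤ, 0 < p i → 0 < p j → (h : ℤ) ∣ i - j) → h = 1

namespace PlaneTree

lemma fringeList_append (F G : List PlaneTree) :
    fringeList (F ++ G) = fringeList F ++ fringeList G := by
  induction F with
  | nil => simp [fringeList]
  | cons t F ih => simp [fringeList, ih]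

/-- The degree statistic of an ordered forest. -/
noncomputable def forestStat (F : List PlaneTree) : ℕ →₀ ℕ :=
  Multiset.toFinsupp (((fringeList F).map degree : List ℕ) : Multiset ℕ)

/-- The number of fringe trees of an ordered forest that belong to `A`. -/
noncomputable def forestCount (A : Finset PlaneTree) (F : List PlaneTree) : ℕ :=
  ((fringeList F).filter fun t => decide (t ∈ A)).length

@[simp] lemma forestStat_nil : forestStat [] = 0 := by
  simp [forestStat, fringeList]

lemma forestStat_append (F G : List PlaneTree) :
    forestStat (F ++ G) = forestStat F + forestStat G := by
  simp only [forestStat, fringeList_append, List.map_append, ← Multiset.coe_add, map_add]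

lemma forestStat_cons (ts G : List PlaneTree) :
    forestStat (node ts :: G) = Finsupp.single ts.length 1 + forestStat (ts ++ G) := by
  rw [forestStat_append]
  simp only [forestStat, fringeList, fringe, List.map_append, List.map_cons, degree,
    ← Multiset.coe_add, map_add, ← Multiset.cons_coe, ← Multiset.singleton_add,
    Multiset.toFinsupp_singleton, add_assoc]

lemma forestStat_singleton (t : PlaneTree) : forestStat [t] = degStat t := by
  simp [forestStat, degStat, fringeList]

lemma forestStat_cons' (t : PlaneTree) (G : List PlaneTree) :
    forestStat (t :: G) = degStat t + forestStat G := by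
  rw [← forestStat_singleton, ← forestStat_append, List.singleton_append]

@[simp] lemma forestCount_nil (A : Finset PlaneTree) : forestCount A [] = 0 := by
  simp [forestCount, fringeList]

lemma forestCount_append (A : Finset PlaneTree) (F G : List PlaneTree) :
    forestCount A (F ++ G) = forestCount A F + forestCount A G := by
  simp [forestCount, fringeList_append]

lemma forestCount_cons (A : Finset PlaneTree) (ts G : List PlaneTree) :
    forestCount A (node ts :: G) = (if node ts ∈ A then 1 else 0) + forestCount A (ts ++ G) := by
  rw [forestCount_append]
  by_cases h : node ts ∈ A <;> (simp [forestCount, fringeList, fringe, h]; try omega)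

section FixedStat

variable {A : Finset PlaneTree} {m : ℕ →₀ ℕ}

lemma forestCount_eq_zero_of_lt {ts : List PlaneTree} (h : forestCount A ts • m ≤ forestStat ts)
    (hts : degStat (node ts) = m) : forestCount A ts = 0 := by
  by_contra h0
  have h1 : m ≤ forestCount A ts • m := by
    obtain ⟨c, hc⟩ := Nat.exists_eq_succ_of_ne_zero h0
    rw [hc, succ_nsmul]
    exact le_add_self
  have h2 := (h1.trans h) ts.length
  rw [← hts, ← forestStat_singleton, forestStat_cons] at h2
  simp at h2

lemma forestCount_smul_le (hA : ∀ t ∈ A, degStat t = m) :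
    ∀ F : List PlaneTree, forestCount A F • m ≤ forestStat F
  | [] => by simp
  | node ts :: G => by
    have h1 := forestCount_smul_le hA ts
    have h2 := forestCount_smul_le hA G
    rw [forestCount_cons, forestCount_append]
    by_cases h : node ts ∈ A
    · rw [forestCount_eq_zero_of_lt h1 (hA _ h), forestStat_cons', hA _ h, if_pos h, zero_add,
        add_smul, one_smul]
      gcongr
    · rw [forestStat_cons, forestStat_append, if_neg h, zero_add, add_smul]
      exact (add_le_add h1 h2).trans le_add_self
termination_by F => sizeOf F

end FixedStat

end PlaneTree

lemma nsize_add (n n' : ℕ →₀ ℕ) : nsize (n + n') = nsize n + nsize n' :=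
  Finsupp.sum_add_index' (fun _ => rfl) fun _ _ _ => rfl

@[simp] lemma nsize_single (d c : ℕ) : nsize (Finsupp.single d c) = c := by
  simp [nsize]

lemma nsize_smul (q : ℕ) (n : ℕ →₀ ℕ) : nsize (q • n) = q * nsize n := by
  induction q with
  | zero => simp [nsize]
  | succ q ih => rw [succ_nsmul, nsize_add, ih]; ring

/-- The total number of children prescribed by a degree statistic. -/
def childCount (n : ℕ →₀ ℕ) : ℕ := n.sum fun i c => i * c

lemma childCount_add (n n' : ℕ →₀ ℕ) : childCount (n + n') = childCount n + childCount n' :=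
  Finsupp.sum_add_index' (fun _ => by simp) fun _ _ _ => by ring

@[simp] lemma childCount_single (d c : ℕ) : childCount (Finsupp.single d c) = d * c := by
  simp [childCount]

/-- The product of the factorials of the entries of a degree statistic. -/
def factorialProd (n : ℕ →₀ ℕ) : ℕ := n.prod fun _ c => c.factorial

lemma factorialProd_add_single (r : ℕ →₀ ℕ) (d : ℕ) :
    factorialProd (r + Finsupp.single d 1) = (r d + 1) * factorialProd r := by
  have h1 : factorialProd (r + Finsupp.single d 1) =
      ∏ i ∈ insert d r.support, ((r + Finsupp.single d 1 : ℕ →₀ ℕ) i).factorial := by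
    refine Finsupp.prod_of_support_subset _ ?_ _ (by simp)
    refine Finsupp.support_add.trans ?_
    intro i hi
    rcases Finset.mem_union.1 hi with h | h
    · exact Finset.mem_insert_of_mem h
    · have := Finsupp.support_single_subset h
      simp_all
  have h2 : factorialProd r = ∏ i ∈ insert d r.support, (r i).factorial :=
    Finsupp.prod_of_support_subset _ (Finset.subset_insert _ _) _ (by simp)
  rw [h1, h2, ← Finset.mul_prod_erase _ _ (Finset.mem_insert_self d _),
    ← Finset.mul_prod_erase (insert d r.support) (fun i => (r i).factorial)
      (Finset.mem_insert_self d _), ← mul_assoc]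
  congr 1
  · simp [Nat.factorial_succ]
  · refine Finset.prod_congr rfl fun i hi => ?_
    rw [Finsupp.add_apply, Finsupp.single_eq_of_ne (Finset.ne_of_mem_erase hi), add_zero]

lemma exists_eq_add_single {n : ℕ →₀ ℕ} {d : ℕ} (h : d ∈ n.support) :
    n = (n - Finsupp.single d 1) + Finsupp.single d 1 := by
  refine (tsub_add_cancel_of_le ?_).symm
  rw [Finsupp.single_le_iff]
  exact Nat.one_le_iff_ne_zero.2 (Finsupp.mem_support_iff.1 h)

namespace PlaneTree

lemma finite_forests (n : ℕ →₀ ℕ) (k : ℕ) :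
    {F : List PlaneTree | F.length = k ∧ forestStat F = n}.Finite := by
  induction hN : nsize n using Nat.strong_induction_on generalizing n k with
  | _ N ih =>
  rcases k with _ | k
  · exact (Set.finite_singleton []).subset fun F hF => List.length_eq_zero_iff.1 hF.1
  have hfin : (⋃ d ∈ n.support, (fun G : List PlaneTree => node (G.take d) :: G.drop d) ''
      {F : List PlaneTree | F.length = k + d ∧ forestStat F = n - Finsupp.single d 1}).Finite := by
    refine Set.Finite.biUnion n.support.finite_toSet fun d hd => Set.Finite.image _ ?_
    refine ih _ ?_ _ _ rfl
    have := congrArg nsize (exists_eq_add_single hd)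
    rw [nsize_add, nsize_single] at this
    omega
  refine hfin.subset ?_
  rintro (_ | ⟨⟨ts⟩, G⟩) ⟨hl, hs⟩
  · simp at hl
  rw [forestStat_cons] at hs
  simp only [List.length_cons, add_left_inj] at hl
  simp only [Set.mem_iUnion, Set.mem_image, Set.mem_ofPred_eq]
  refine ⟨ts.length, ?_, ts ++ G, ⟨?_, ?_⟩, ?_⟩
  · simp [← hs]
  · simp [hl, add_comm]
  · simp [← hs]
  · simp

/-- The ordered forests of `k` trees with degree statistic `n`. -/
noncomputable def forests (k : ℕ) (n : ℕ →₀ ℕ) : Finset (List PlaneTree) :=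
  (finite_forests n k).toFinset

@[simp] lemma mem_forests {k : ℕ} {n : ℕ →₀ ℕ} {F : List PlaneTree} :
    F ∈ forests k n ↔ F.length = k ∧ forestStat F = n := by
  simp [forests]

/-- Delete the root of the first tree of an ordered forest. -/
def removeRoot : List PlaneTree → List PlaneTree
  | [] => []
  | node ts :: G => ts ++ G

lemma sum_forests_removeRoot (k : ℕ) (n : ℕ →₀ ℕ) (u : List PlaneTree → ℕ) :
    ∑ F ∈ forests (k + 1) n, u (removeRoot F) =
      ∑ d ∈ n.support, ∑ G ∈ forests (k + d) (n - Finsupp.single d 1), u G := by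
  rw [Finset.sum_sigma']
  refine Finset.sum_bij' (fun F _ => ⟨(F.headD (node [])).degree, removeRoot F⟩)
    (fun x _ => node (x.2.take x.1) :: x.2.drop x.1) ?_ ?_ ?_ ?_ ?_
  · rintro (_ | ⟨⟨ts⟩, G⟩) hF
    · simp at hF
    rw [mem_forests, forestStat_cons] at hF
    obtain ⟨hl, hs⟩ := hF
    simp only [List.length_cons, add_left_inj] at hl
    simp [degree, removeRoot, ← hs, hl, add_comm]
  · rintro ⟨d, G⟩ hx
    simp only [Finset.mem_sigma, mem_forests] at hx
    obtain ⟨hd, hl, hs⟩ := hx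
    dsimp only
    rw [mem_forests, forestStat_cons, List.take_append_drop, hs, add_comm (Finsupp.single _ _),
      List.length_take, min_eq_left (by omega), ← exists_eq_add_single hd]
    simp only [List.length_cons, List.length_drop, hl]
    exact ⟨by omega, trivial⟩
  · rintro (_ | ⟨⟨ts⟩, G⟩) hF
    · simp at hF
    simp [degree, removeRoot]
  · rintro ⟨d, G⟩ hx
    simp only [Finset.mem_sigma, mem_forests] at hx
    obtain ⟨hd, hl, hs⟩ := hx
    simp [degree, removeRoot, hl]
  · intros; rfl

lemma sum_forests_head (k : ℕ) {m : ℕ →₀ ℕ} (n : ℕ →₀ ℕ) {A : Finset PlaneTree}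
    (hA : ∀ t ∈ A, degStat t = m) (u : List PlaneTree → ℕ) :
    (∑ F ∈ forests (k + 1) (m + n), if F.headD (node []) ∈ A then u F.tail else 0) =
      A.card * ∑ G ∈ forests k n, u G := by
  rw [← Finset.sum_filter, ← smul_eq_mul, ← Finset.sum_const, ← Finset.sum_product']
  refine Finset.sum_bij' (fun F _ => (F.headD (node []), F.tail))
    (fun x _ => x.1 :: x.2) ?_ ?_ ?_ ?_ ?_
  · rintro (_ | ⟨t, G⟩) hF
    · simp at hF
    simp only [Finset.mem_filter, mem_forests, forestStat_cons', List.headD_cons] at hF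
    obtain ⟨⟨hl, hs⟩, ht⟩ := hF
    rw [hA t ht, add_right_inj] at hs
    simp_all
  · rintro ⟨t, G⟩ hx
    simp only [Finset.mem_product, mem_forests] at hx
    simp [forestStat_cons', hx.1, hA t hx.1, hx.2.1, hx.2.2]
  · rintro (_ | ⟨t, G⟩) hF
    · simp at hF
    rfl
  · intros; rfl
  · intros; rfl

end PlaneTree

lemma descFactorial_succ_left (c q : ℕ) :
    (c + 1).descFactorial q = c.descFactorial q + q * c.descFactorial (q - 1) := by
  rcases q with _ | q
  · simp
  rw [Nat.succ_descFactorial_succ, Nat.descFactorial_succ, Nat.add_sub_cancel, ← add_mul]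
  by_cases h : q ≤ c
  · congr 1; omega
  · rw [Nat.descFactorial_of_lt (by omega)]; simp

namespace PlaneTree

/-- The sum over all forests of `k` trees with degree statistic `n` of the `q`-th falling
factorial of the number of fringe trees in `A`. -/
noncomputable def factorialSum (A : Finset PlaneTree) (q k : ℕ) (n : ℕ →₀ ℕ) : ℕ :=
  ∑ F ∈ forests k n, (forestCount A F).descFactorial q

section FixedStat

variable {A : Finset PlaneTree} {m : ℕ →₀ ℕ}

lemma factorialSum_eq_zero (hA : ∀ t ∈ A, degStat t = m) {q : ℕ} {n : ℕ →₀ ℕ} (k : ℕ)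
    (h : ¬ q • m ≤ n) : factorialSum A q k n = 0 := by
  refine Finset.sum_eq_zero fun F hF => Nat.descFactorial_of_lt ?_
  by_contra! hq
  refine h (le_trans ?_ ((forestCount_smul_le hA F).trans_eq (mem_forests.1 hF).2))
  gcongr

lemma descFactorial_forestCount (hA : ∀ t ∈ A, degStat t = m) (q : ℕ) {F : List PlaneTree}
    (hF : F ≠ []) : (forestCount A F).descFactorial q =
      (forestCount A (removeRoot F)).descFactorial q +
        if F.headD (node []) ∈ A then q * (forestCount A F.tail).descFactorial (q - 1) else 0 := by
  rcases F with _ | ⟨⟨ts⟩, G⟩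
  · exact absurd rfl hF
  rw [removeRoot, List.tail_cons, forestCount_cons]
  by_cases h : node ts ∈ A
  · rw [if_pos h, if_pos (by exact h), add_comm, descFactorial_succ_left, forestCount_append,
      forestCount_eq_zero_of_lt (forestCount_smul_le hA ts) (hA _ h), zero_add]
  · rw [if_neg h, if_neg (by exact h), zero_add, add_zero]

lemma factorialSum_succ (hA : ∀ t ∈ A, degStat t = m) (q k : ℕ) (n : ℕ →₀ ℕ) :
    factorialSum A q (k + 1) n =
      ∑ d ∈ n.support, factorialSum A q (k + d) (n - Finsupp.single d 1) +
        ∑ F ∈ forests (k + 1) n, if F.headD (node []) ∈ A then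
          q * (forestCount A F.tail).descFactorial (q - 1) else 0 := by
  unfold factorialSum
  rw [← sum_forests_removeRoot k n fun G => (forestCount A G).descFactorial q,
    ← Finset.sum_add_distrib]
  refine Finset.sum_congr rfl fun F hF => descFactorial_forestCount hA q ?_
  rintro rfl
  simp at hF

lemma factorialSum_succ_smul (hA : ∀ t ∈ A, degStat t = m) (q k : ℕ) (r : ℕ →₀ ℕ) :
    factorialSum A q (k + 1) (q • m + r) =
      ∑ d ∈ r.support, factorialSum A q (k + d) (q • m + (r - Finsupp.single d 1)) +
        q * A.card * factorialSum A (q - 1) k ((q - 1) • m + r) := by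
  rw [factorialSum_succ hA]
  congr 1
  · have hsub : r.support ⊆ (q • m + r).support := by
      intro d hd
      simp only [Finsupp.mem_support_iff, Finsupp.add_apply] at hd ⊢
      omega
    rw [← Finset.sum_subset hsub]
    · refine Finset.sum_congr rfl fun d hd => ?_
      congr 1
      conv_lhs => rw [exists_eq_add_single hd]
      rw [← add_assoc, add_tsub_cancel_right]
    · intro d hd hd'
      refine factorialSum_eq_zero hA _ fun hle => ?_
      have h1 := hle d
      simp only [Finsupp.mem_support_iff, not_not, Finsupp.tsub_apply, Finsupp.add_apply,
        Finsupp.single_eq_same] at hd hd' h1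
      omega
  · rcases q with _ | q
    · simp
    · rw [succ_nsmul', add_assoc, sum_forests_head k _ hA
        fun G => (q + 1) * (forestCount A G).descFactorial (q + 1 - 1), ← Finset.mul_sum]
      simp only [Nat.add_sub_cancel, factorialSum]
      ring

/-- The number `k / N * N!`, read as `1` for `N = 0`. -/
def ballot (k : ℕ) : ℕ → ℕ
  | 0 => 1
  | N + 1 => k * N.factorial

lemma ballot_succ {k N : ℕ} (q : ℕ) (r : ℕ →₀ ℕ) (h1 : nsize r + q = N + 1)
    (h2 : childCount r + k = N) :
    ballot (k + 1) (N + 1) = (∑ d ∈ r.support, r d * ballot (k + d) N) + q * ballot k N := by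
  have hs : nsize r = ∑ d ∈ r.support, r d := rfl
  have hc : childCount r = ∑ d ∈ r.support, d * r d := rfl
  rcases N with _ | N
  · simp only [ballot, mul_one, ← hs, h1, Nat.factorial_zero]
    omega
  · simp only [ballot]
    have h3 : ∑ d ∈ r.support, r d * ((k + d) * N.factorial) =
        (k * nsize r + childCount r) * N.factorial := by
      rw [hs, hc, Finset.mul_sum, ← Finset.sum_add_distrib, Finset.sum_mul]
      exact Finset.sum_congr rfl fun d _ => by ring
    rw [h3, Nat.factorial_succ]
    have h4 : (k + 1) * (N + 1) = k * nsize r + childCount r + q * k := by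
      have : k * (nsize r + q) = k * (N + 2) := by rw [h1]
      nlinarith
    calc (k + 1) * ((N + 1) * N.factorial) = (k + 1) * (N + 1) * N.factorial := by ring
      _ = _ := by rw [h4]; ring

lemma factorialSum_mul_factorialProd (hA : ∀ t ∈ A, degStat t = m) (q k : ℕ) (r : ℕ →₀ ℕ)
    (h : nsize r + q = k + childCount r) :
    factorialSum A q k (q • m + r) * factorialProd r = A.card ^ q * ballot k (nsize r + q) := by
  induction hN : nsize r + q generalizing q k r with
  | zero =>
    obtain rfl : q = 0 := by omega
    obtain rfl : k = 0 := by omega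
    obtain rfl : r = 0 := by
      ext i
      by_contra hi
      have : r i ≤ nsize r := Finset.single_le_sum (f := r) (fun _ _ => Nat.zero_le _)
        (Finsupp.mem_support_iff.2 hi)
      simp only [Finsupp.coe_zero, Pi.zero_apply] at hi
      omega
    have : forests 0 0 = {[]} := by
      ext F
      simp only [mem_forests, List.length_eq_zero_iff, Finset.mem_singleton, and_iff_left_iff_imp]
      rintro rfl
      exact forestStat_nil
    simp [factorialSum, this, factorialProd, ballot]
  | succ N ih =>
    rcases k with _ | k
    · rw [ballot, zero_mul, mul_zero, factorialSum, Finset.sum_eq_zero, zero_mul]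
      intro F hF
      obtain ⟨hl, hs⟩ := mem_forests.1 hF
      obtain rfl := List.length_eq_zero_iff.1 hl
      rw [forestCount_nil, Nat.descFactorial_of_lt]
      by_contra! hq
      obtain rfl : q = 0 := by omega
      rw [forestStat_nil, zero_smul, zero_add] at hs
      simp [← hs, nsize] at hN
    rw [factorialSum_succ_smul hA, ballot_succ q r hN (by omega), add_mul, mul_add,
      Finset.sum_mul, Finset.mul_sum]
    congr 1
    · refine Finset.sum_congr rfl fun d hd => ?_
      have hr := exists_eq_add_single hd
      have h1 := congrArg nsize hr
      have h2 := congrArg childCount hr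
      have h3 := congrArg factorialProd hr
      have h4 := DFunLike.congr_fun hr d
      rw [nsize_add, nsize_single] at h1
      rw [childCount_add, childCount_single, mul_one] at h2
      rw [factorialProd_add_single] at h3
      rw [Finsupp.add_apply, Finsupp.single_eq_same] at h4
      rw [← h4] at h3
      have := ih q (k + d) (r - Finsupp.single d 1) (by omega) (by omega)
      rw [h3, mul_left_comm, this]
      ring
    · rcases q with _ | q
      · simp
      · have := ih q k r (by omega) (by omega)
        rw [Nat.add_sub_cancel, mul_assoc, this]
        ring

end FixedStat

end PlaneTree

lemma finite_treesWith (n : ℕ →₀ ℕ) : (treesWith n).Finite := by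
  refine ((PlaneTree.finite_forests n 1).preimage (f := fun t => [t]) ?_).subset ?_
  · exact fun _ _ _ _ h => List.singleton_injective h
  · intro t ht
    exact ⟨rfl, (PlaneTree.forestStat_singleton t).trans ht⟩

lemma numTrees_eq_card (n : ℕ →₀ ℕ) : numTrees n = (finite_treesWith n).toFinset.card :=
  Set.ncard_eq_toFinset_card _ _

lemma expect_eq_sum_div (n : ℕ →₀ ℕ) (f : PlaneTree → ℕ) :
    expect n f = ((∑ T ∈ (finite_treesWith n).toFinset, f T : ℕ) : ℝ) / numTrees n := by
  set s := (finite_treesWith n).toFinset with hs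
  have hp (k : ℕ) : {T ∈ treesWith n | f T = k}.ncard = (s.filter fun T => f T = k).card := by
    rw [← Set.ncard_coe_finset]
    congr 1
    ext T
    simp [hs]
  have hsum : ∑ T ∈ s, f T = ∑ k ∈ s.image f, (s.filter fun T => f T = k).card * k := by
    simpa using Finset.sum_comp (fun k : ℕ => k) f (s := s)
  unfold expect prob
  simp only [hp]
  rw [tsum_eq_sum (s := s.image f), hsum, Nat.cast_sum, Finset.sum_div]
  · refine Finset.sum_congr rfl fun k _ => ?_
    push_cast
    ring
  · intro k hk
    rw [Finset.filter_eq_empty_iff.2]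
    · simp
    · rintro T hT rfl
      exact hk (Finset.mem_image_of_mem f hT)

namespace PlaneTree

lemma sum_treesWith (n : ℕ →₀ ℕ) (u : List PlaneTree → ℕ) :
    ∑ T ∈ (finite_treesWith n).toFinset, u [T] = ∑ F ∈ forests 1 n, u F := by
  refine Finset.sum_bij (fun T _ => [T]) ?_ ?_ ?_ ?_
  · intro T hT
    rw [Set.Finite.mem_toFinset] at hT
    exact mem_forests.2 ⟨rfl, (forestStat_singleton T).trans hT⟩
  · exact fun _ _ _ _ h => List.singleton_injective h
  · intro F hF
    obtain ⟨hl, hs⟩ := mem_forests.1 hF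
    obtain ⟨T, rfl⟩ := List.length_eq_one_iff.1 hl
    rw [forestStat_singleton] at hs
    exact ⟨T, by simpa [treesWith] using hs, rfl⟩
  · intros; rfl

lemma expect_forestCount (A : Finset PlaneTree) (q : ℕ) (n : ℕ →₀ ℕ) :
    expect n (fun T => (forestCount A [T]).descFactorial q) =
      (factorialSum A q 1 n : ℝ) / numTrees n := by
  rw [expect_eq_sum_div, sum_treesWith n fun F => (forestCount A F).descFactorial q]
  rfl

lemma numTrees_mul_factorialProd {n : ℕ →₀ ℕ} (hn : nsize n = 1 + childCount n) :
    numTrees n * factorialProd n = (nsize n - 1).factorial := by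
  have h0 : factorialSum ∅ 0 1 n = numTrees n := by
    rw [numTrees_eq_card, Finset.card_eq_sum_ones,
      sum_treesWith n fun _ => 1]
    simp [factorialSum]
  have h := factorialSum_mul_factorialProd (A := ∅) (m := 0) (by simp) 0 1 n hn
  rw [smul_zero, zero_add, h0, add_zero, pow_zero, one_mul] at h
  obtain ⟨N, hN⟩ : ∃ N, nsize n = N + 1 := ⟨childCount n, by omega⟩
  rw [h, hN, ballot, one_mul, Nat.add_sub_cancel]

end PlaneTree

lemma prod_descFactorial_mul_factorialProd (q : ℕ) (m r : ℕ →₀ ℕ) :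
    (m.prod fun i c => ((q • m + r) i).descFactorial (q * c)) * factorialProd r =
      factorialProd (q • m + r) := by
  set s := m.support ∪ r.support with hs
  have h1 : (m.prod fun i c => ((q • m + r) i).descFactorial (q * c)) =
      ∏ i ∈ s, ((q • m + r) i).descFactorial (q * m i) :=
    Finsupp.prod_of_support_subset _ Finset.subset_union_left _ (by simp)
  have h2 : factorialProd r = ∏ i ∈ s, (r i).factorial :=
    Finsupp.prod_of_support_subset _ Finset.subset_union_right _ (by simp)
  have h3 : factorialProd (q • m + r) = ∏ i ∈ s, ((q • m + r) i).factorial := by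
    refine Finsupp.prod_of_support_subset _ ?_ _ (by simp)
    exact Finsupp.support_add.trans (Finset.union_subset_union_left Finsupp.support_smul)
  rw [h1, h2, h3, ← Finset.prod_mul_distrib]
  refine Finset.prod_congr rfl fun i _ => ?_
  rw [Finsupp.add_apply, Finsupp.smul_apply, smul_eq_mul, mul_comm]
  simpa using Nat.factorial_mul_descFactorial (Nat.le_add_right (q * m i) (r i))

namespace PlaneTree

lemma expect_descFactorial_forestCount {n m : ℕ →₀ ℕ} (hn : IsDegStat n) (hm : IsDegStat m)
    (q : ℕ) {A : Finset PlaneTree} (hA : ∀ t ∈ A, degStat t = m) :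
    expect n (fun T => (forestCount A [T]).descFactorial q) =
      (A.card : ℝ) ^ q *
        ((nsize n : ℝ) / ((nsize n).descFactorial (q * nsize m - q + 1) : ℝ)) *
        m.prod (fun i c => ((n i).descFactorial (q * c) : ℝ)) := by
  replace hn : nsize n = 1 + childCount n := hn
  replace hm : nsize m = 1 + childCount m := hm
  rw [expect_forestCount]
  by_cases hle : q • m ≤ n
  · obtain ⟨r, rfl⟩ := exists_add_of_le hle
    have hchild : childCount (q • m) = q * childCount m := by
      clear hn hm hle hA
      induction q with
      | zero => simp [childCount]
      | succ q ih => rw [succ_nsmul, childCount_add, ih]; ring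
    have hsize : nsize (q • m + r) = q * nsize m + nsize r := by rw [nsize_add, nsize_smul]
    have hr : nsize r + q = 1 + childCount r := by
      rw [hsize, childCount_add, hchild, hm] at hn
      linarith
    obtain ⟨P, hP⟩ : ∃ P, nsize r + q = P + 1 := ⟨childCount r, by omega⟩
    have hqm : q ≤ q * nsize m := Nat.le_mul_of_pos_right q (by omega)
    have e1 := factorialSum_mul_factorialProd hA q 1 r hr
    rw [hP, ballot, one_mul] at e1
    have e2 := numTrees_mul_factorialProd hn
    have e3 := prod_descFactorial_mul_factorialProd q m r
    have e4 := Nat.factorial_mul_descFactorial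
      (show q * nsize m - q + 1 ≤ nsize (q • m + r) by omega)
    rw [show nsize (q • m + r) - (q * nsize m - q + 1) = P by omega,
      ← Nat.mul_factorial_pred (n := nsize (q • m + r)) (by omega)] at e4
    have hR : factorialProd r ≠ 0 := Finset.prod_ne_zero_iff.2 fun _ _ => Nat.factorial_ne_zero _
    have hN : numTrees (q • m + r) ≠ 0 := fun h0 => by
      rw [h0, zero_mul] at e2
      exact Nat.factorial_ne_zero _ e2.symm
    have hD : (nsize (q • m + r)).descFactorial (q * nsize m - q + 1) ≠ 0 := by
      rw [Ne, Nat.descFactorial_eq_zero_iff_lt]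
      omega
    have hprod : (m.prod fun i c => (((q • m + r) i).descFactorial (q * c) : ℝ)) =
        ((m.prod fun i c => ((q • m + r) i).descFactorial (q * c) : ℕ) : ℝ) := by
      simp [Finsupp.prod]
    rw [hprod]
    generalize (m.prod fun i c => ((q • m + r) i).descFactorial (q * c) : ℕ) = X at *
    generalize (nsize (q • m + r)).descFactorial (q * nsize m - q + 1) = D at *
    generalize nsize (q • m + r) = s at *
    generalize factorialSum A q 1 (q • m + r) = S at *
    generalize numTrees (q • m + r) = N at *
    rw [← e2, ← e3] at e4
    have key : S * D = A.card ^ q * s * X * N := by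
      apply Nat.eq_of_mul_eq_mul_right (Nat.pos_of_ne_zero hR)
      calc S * D * factorialProd r = S * factorialProd r * D := by ring
        _ = A.card ^ q * (P.factorial * D) := by rw [e1]; ring
        _ = _ := by rw [e4]; ring
    have hN' : (N : ℝ) ≠ 0 := Nat.cast_ne_zero.2 hN
    have hD' : (D : ℝ) ≠ 0 := Nat.cast_ne_zero.2 hD
    have key' : (S : ℝ) * D = (A.card : ℝ) ^ q * s * X * N := by exact_mod_cast key
    field_simp
    linarith
  · rw [factorialSum_eq_zero hA 1 hle]
    obtain ⟨i, hi⟩ : ∃ i, n i < q * m i := by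
      by_contra! h
      exact hle fun i => by simpa using h i
    have : (m.prod fun i c => ((n i).descFactorial (q * c) : ℝ)) = 0 := by
      refine Finset.prod_eq_zero (i := i) ?_ ?_
      · rw [Finsupp.mem_support_iff]
        rintro h0
        simp [h0] at hi
      · exact Nat.cast_eq_zero.2 (Nat.descFactorial_of_lt hi)
    rw [this]
    simp

lemma countStat_eq_forestCount (m : ℕ →₀ ℕ) (T : PlaneTree) :
    countStat m T = forestCount (finite_treesWith m).toFinset [T] := by
  simp [countStat, forestCount, fringeList, treesWith]

lemma countTree_eq_forestCount (T' T : PlaneTree) :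
    countTree T' T = forestCount {T'} [T] := by
  simp [countTree, forestCount, fringeList]

end PlaneTree

/-- Lemma 5.1: factorial moments of the number of fringe trees with a given degree statistic. -/
theorem factorial_moment_countStat
    (n m : ℕ →₀ ℕ) (hn : IsDegStat n) (hm : IsDegStat m) (q : ℕ) (hq : 0 < q) :
    expect n (fun T => (PlaneTree.countStat m T).descFactorial q) =
      (numTrees m : ℝ) ^ q *
        ((nsize n : ℝ) / ((nsize n).descFactorial (q * nsize m - q + 1) : ℝ)) *
        m.prod (fun i c => ((n i).descFactorial (q * c) : ℝ)) ∧
    ∀ T : PlaneTree, PlaneTree.degStat T = m →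
      expect n (fun T' => (PlaneTree.countStat m T').descFactorial q) =
        (numTrees m : ℝ) ^ q *
          expect n (fun T' => (PlaneTree.countTree T T').descFactorial q) := by
  have h1 := PlaneTree.expect_descFactorial_forestCount hn hm q
    (A := (finite_treesWith m).toFinset) (by simp [treesWith])
  rw [← numTrees_eq_card] at h1
  simp only [PlaneTree.countStat_eq_forestCount, PlaneTree.countTree_eq_forestCount]
  refine ⟨h1, fun T hT => ?_⟩
  rw [h1, PlaneTree.expect_descFactorial_forestCount hn hm q (A := {T}) (by simpa using hT),
    Finset.card_singleton, Nat.cast_one, one_pow, one_mul, mul_assoc]
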